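/- arXiv:q-alg/9506021 — 2 statements merged into one kernel-verified Lean document; each statement's English description precedes it below -/
import Mathlib

section
/- Fix an integer r ≥ 2. (1) For every α ∈ M and every σ ∈ S_∞: S^(r)_{σα}(t) = sgn(σ)·S^(r)_α(t) in P^(r). (2) For every α ∈ M and every j ≥ 1: Σ_{i≥1} S^(r)_{α+jrε_i}(t) = 0 in P^(r), where all but finitely many summands are zero. -/
open scoped BigOperators Classical

namespace RSF

/-! ### Partitions -/

/-- A partition, encoded as its (0-indexed, weakly decreasing, eventually zero)
sequence of parts: `f (j-1) = λ_j`. -/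
def IsPartition (f : ℕ → ℕ) : Prop :=
  (∀ i j : ℕ, i ≤ j → f j ≤ f i) ∧ ∃ N : ℕ, ∀ i : ℕ, N ≤ i → f i = 0

/-- The size `|λ|` of a partition. -/
noncomputable def psize (f : ℕ → ℕ) : ℕ := ∑ᶠ i, f i

/-- The number of (nonzero) parts of a partition. -/
noncomputable def plen (f : ℕ → ℕ) : ℕ := sInf {N : ℕ | ∀ i : ℕ, N ≤ i → f i = 0}

/-- The empty partition. -/
def emptyPart : ℕ → ℕ := fun _ => 0

/-- The transpose (conjugate) partition: `λ'_i = #{j : λ_j ≥ i}` (0-indexed). -/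
noncomputable def transposeP (f : ℕ → ℕ) : ℕ → ℕ := fun i => Nat.card {j : ℕ // i < f j}

/-! ### Symmetric functions, Schur functions, Littlewood-Richardson coefficients -/

/-- The ring of symmetric functions `Λ = ℚ[p_1, p_2, …]`; the variable `m` stands for the
power sum `p_{m+1}`. -/
abbrev SymmAlg : Type := MvPolynomial ℕ ℚ

/-- The power sum `p_j ∈ Λ` (for `j ≥ 1`). -/
noncomputable def pwr (j : ℕ) : SymmAlg := MvPolynomial.X (j - 1)

/-- Evaluation `ev_n : Λ → ℚ[x_1,…,x_n]`, sending `p_j` to `x_1^j + ⋯ + x_n^j`. -/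
noncomputable def ev (n : ℕ) : SymmAlg →ₐ[ℚ] MvPolynomial (Fin n) ℚ :=
  MvPolynomial.aeval fun j => ∑ i : Fin n, MvPolynomial.X i ^ (j + 1)

/-- The matrix `(x_i^{λ_j + n - j})_{1 ≤ i,j ≤ n}` (0-indexed). -/
noncomputable def schurMat (f : ℕ → ℕ) (n : ℕ) :
    Matrix (Fin n) (Fin n) (MvPolynomial (Fin n) ℚ) :=
  Matrix.of fun i j => MvPolynomial.X i ^ (f (j : ℕ) + (n - 1 - (j : ℕ)))

/-- `S` is the family of Schur functions: for every partition `λ` and every `n` at least the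
number of parts of `λ`, `ev_n (S_λ) = det(x_i^{λ_j+n-j}) / det(x_i^{n-j})`.
(This determines `S_λ` uniquely.) -/
def IsSchurFamily (S : (ℕ → ℕ) → SymmAlg) : Prop :=
  ∀ f : ℕ → ℕ, IsPartition f → ∀ n : ℕ, plen f ≤ n →
    ev n (S f) * (schurMat emptyPart n).det = (schurMat f n).det

/-- `LR` is the family of (multi-factor) Littlewood–Richardson coefficients of the Schur
family `S`: `S_{μ_1} ⋯ S_{μ_m} = Σ_λ LR^λ_{μ_1⋯μ_m} S_λ`. -/
def IsLRFamily (S : (ℕ → ℕ) → SymmAlg) (LR : (ℕ → ℕ) → List (ℕ → ℕ) → ℚ) : Prop :=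
  (∀ lam L, ¬ IsPartition lam → LR lam L = 0) ∧
  (∀ lam L, LR lam L ≠ 0 → psize lam = (L.map psize).sum) ∧
  (∀ L : List (ℕ → ℕ), (∀ g ∈ L, IsPartition g) →
    (L.map S).prod = ∑ᶠ lam : ℕ → ℕ, LR lam L • S lam)

/-- The ring `P^(r) = ℚ[t_j : j ≥ 1, r ∤ j]`. -/
abbrev PR (r : ℕ) : Type := MvPolynomial {j : ℕ // 0 < j ∧ ¬ r ∣ j} ℚ

/-- The homomorphism `ρ^(r) : Λ → P^(r)`, `p_j ↦ j·t_j` if `r ∤ j`, `p_j ↦ 0` if `r ∣ j`. -/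
noncomputable def rho (r : ℕ) : SymmAlg →ₐ[ℚ] PR r :=
  MvPolynomial.aeval fun m =>
    if h : r ∣ (m + 1) then 0
    else ((m + 1 : ℕ) : ℚ) • MvPolynomial.X ⟨m + 1, Nat.succ_pos m, h⟩

/-! ### Beta-sets, cores, quotients, and the `r`-sign -/

/-- The beta-set `{λ_i + N - i : 1 ≤ i ≤ N}` of a partition (first-`N` beta numbers);
it is the set of nonnegative entries of the representative of the corresponding Maya
diagram whose negative entries are exactly `{-1, -2, -3, …}` and which has `N`
nonnegative entries. -/
def betaFinset (f : ℕ → ℕ) (N : ℕ) : Finset ℕ :=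
  (Finset.range N).image fun i => f i + (N - 1 - i)

/-- The elements of a finite set of naturals, listed in decreasing order. -/
def descSort (s : Finset ℕ) : List ℕ := (s.sort (· ≤ ·)).reverse

/-- The partition whose beta-set (with `s.card` beta numbers) is `s`:
`λ_j = b_j - (card - j)` where `b_1 > b_2 > ⋯` are the elements of `s`. -/
def partOfBeta (s : Finset ℕ) : ℕ → ℕ :=
  fun j => (descSort s).getD j 0 - (s.card - 1 - j)

/-- A canonical choice of `N`: a multiple of `r` which is at least the number of parts.
(The constructions below are independent of this choice.) -/
noncomputable def defaultN (r : ℕ) (f : ℕ → ℕ) : ℕ := r * (plen f + 1)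

/-- The `k`-th component `λ[k]` of the `r`-quotient of a partition. -/
noncomputable def quotP (r : ℕ) (f : ℕ → ℕ) (k : ℕ) : ℕ → ℕ :=
  partOfBeta (((betaFinset f (defaultN r f)).filter fun b => b % r = k).image
    fun b => (b - k) / r)

/-- The `r`-core `λ_c` of a partition. -/
noncomputable def coreP (r : ℕ) (f : ℕ → ℕ) : ℕ → ℕ :=
  partOfBeta ((Finset.range r).biUnion fun k =>
    (Finset.range (((betaFinset f (defaultN r f)).filter fun b => b % r = k).card)).image
      fun j => j * r + k)

/-- The interleaved reading of the nonnegative entries: for `j = 1, 2, …` and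
`k = 0, …, r-1`, the `j`-th largest beta number congruent to `k` mod `r` (if it exists). -/
def interleaveAt (r N : ℕ) (f : ℕ → ℕ) : List ℕ :=
  (List.range N).flatMap fun j =>
    (List.range r).filterMap fun k =>
      (descSort ((betaFinset f N).filter fun b => b % r = k))[j]?

/-- The number of inversions of a list of naturals with respect to decreasing order. -/
def invCount (L : List ℕ) : ℕ :=
  ((Finset.range L.length ×ˢ Finset.range L.length).filter fun pq =>
    pq.1 < pq.2 ∧ L.getD pq.1 0 < L.getD pq.2 0).card

/-- The sign of the permutation sorting the interleaved reading of the nonnegative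
entries of the chosen representative into decreasing order. -/
def deltaSignAt (r N : ℕ) (f : ℕ → ℕ) : ℤ := (-1) ^ invCount (interleaveAt r N f)

/-- The `r`-sign `δ_r(λ)`: the sign of the permutation sorting the interleaved reading of
the nonnegative entries into decreasing order.  (It is normalized relative to the `r`-core,
so as to be independent of the choice of representative; on `r`-cores it is `+1`.) -/
noncomputable def deltaSign (r : ℕ) (f : ℕ → ℕ) : ℤ :=
  deltaSignAt r (defaultN r f) f * deltaSignAt r (defaultN r f) (coreP r f)

/-! ### Generalized Maya diagrams -/

/-- A generalized Maya diagram (as a sequence): `α_{i+1} = α_i - 1` for all large `i`. -/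
def IsMaya (a : ℕ → ℤ) : Prop := ∃ N : ℕ, ∀ i : ℕ, N ≤ i → a (i + 1) = a i - 1

/-- A strictly decreasing sequence (member of `M_d`). -/
def StrictDec (a : ℕ → ℤ) : Prop := ∀ i j : ℕ, i < j → a j < a i

/-- The action of `S_n ⊆ S_∞` on sequences, permuting the first `n` entries. -/
def permAct {n : ℕ} (σ : Equiv.Perm (Fin n)) (a : ℕ → ℤ) : ℕ → ℤ :=
  fun i => if h : i < n then a ((σ⁻¹ ⟨i, h⟩ : Fin n) : ℕ) else a i

/-- `f = λ(a)` : the partition associated with a strictly decreasing Maya sequence,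
`λ_j = a_j - a_n + (j - n)` for all sufficiently large `n`. -/
def MayaCorresponds (a : ℕ → ℤ) (f : ℕ → ℕ) : Prop :=
  ∃ N : ℕ, ∀ n : ℕ, N ≤ n → ∀ j : ℕ, j ≤ n →
    (f j : ℤ) = a j - a n + (j : ℤ) - (n : ℤ)

/-- `α + c·ε_i` : increase the `i`-th entry by `c`. -/
def addAt (a : ℕ → ℤ) (i : ℕ) (c : ℤ) : ℕ → ℤ := Function.update a i (a i + c)

/-- `SM` extends the Schur family `S` to generalized Maya diagrams:
`S_α = sgn(σ)·S_{λ(σα)}` when `σα` is strictly decreasing, and `S_α = 0` when `α` has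
two equal entries. -/
def IsMayaSchur (S : (ℕ → ℕ) → SymmAlg) (SM : (ℕ → ℤ) → SymmAlg) : Prop :=
  (∀ a : ℕ → ℤ, IsMaya a → (∃ i j : ℕ, i ≠ j ∧ a i = a j) → SM a = 0) ∧
  (∀ a : ℕ → ℤ, IsMaya a → ∀ (n : ℕ) (σ : Equiv.Perm (Fin n)) (f : ℕ → ℕ),
    StrictDec (permAct σ a) → MayaCorresponds (permAct σ a) f →
    SM a = ((Equiv.Perm.sign σ : ℤ) : ℚ) • S f)

/-- The `k`-th piece `α[k]` of the `r`-quotient of a Maya sequence (in its canonical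
representative): the subsequence of entries congruent to `k` mod `r`, with
`α^{(k)}_i ↦ (α^{(k)}_i - k)/r`. -/
noncomputable def mayaQuot (r : ℕ) (b : ℕ → ℤ) (k : ℕ) : ℕ → ℤ :=
  fun i => (b (Nat.nth (fun m => b m % (r : ℤ) = (k : ℤ)) i) - (k : ℤ)) / (r : ℤ)

/-! ### The space `U` -/

/-- Maya sequences. -/
def MSeq : Type := {a : ℕ → ℤ // IsMaya a}

/-- Two Maya sequences are equivalent iff they differ by a constant. -/
def mayaSetoid : Setoid MSeq where
  r a b := ∃ c : ℤ, ∀ i : ℕ, a.1 i = b.1 i + c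
  iseqv := by
    refine ⟨fun a => ⟨0, fun i => by ring⟩, ?_, ?_⟩
    · rintro a b ⟨c, h⟩
      exact ⟨-c, fun i => by have := h i; omega⟩
    · rintro a b c ⟨x, h⟩ ⟨y, h'⟩
      exact ⟨x + y, fun i => by have := h i; have := h' i; omega⟩

/-- The set `M` of generalized Maya diagrams. -/
def MayaCl : Type := Quotient mayaSetoid

/-- Permuting the first `n` entries preserves Maya sequences. -/
def permActM {n : ℕ} (σ : Equiv.Perm (Fin n)) (a : MSeq) : MSeq :=
  ⟨permAct σ a.1, by
    obtain ⟨N, hN⟩ := a.2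
    refine ⟨max N n, fun i hi => ?_⟩
    have h1 : ¬ i < n := by omega
    have h2 : ¬ i + 1 < n := by omega
    simp only [permAct, dif_neg h1, dif_neg h2]
    exact hN i (le_trans (le_max_left _ _) hi)⟩

/-- `α + c·ε_i` as a Maya sequence. -/
def addAtM (a : MSeq) (i : ℕ) (c : ℤ) : MSeq :=
  ⟨addAt a.1 i c, by
    obtain ⟨N, hN⟩ := a.2
    refine ⟨max N (i + 1), fun m hm => ?_⟩
    have h1 : m ≠ i := by omega
    have h2 : m + 1 ≠ i := by omega
    simp only [addAt, Function.update_apply, if_neg h1, if_neg h2]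
    exact hN m (le_trans (le_max_left _ _) hm)⟩

/-- The ℚ-vector space with basis `{u_α : α ∈ M}`. -/
abbrev FreeM : Type := MayaCl →₀ ℚ

/-- The vectors `u_{σα} - sgn(σ)·u_α`. -/
def relSet : Set FreeM :=
  {v | ∃ (a : MSeq) (n : ℕ) (σ : Equiv.Perm (Fin n)),
    v = Finsupp.single (Quotient.mk mayaSetoid (permActM σ a)) 1
      - ((Equiv.Perm.sign σ : ℤ) : ℚ) • Finsupp.single (Quotient.mk mayaSetoid a) 1}

/-- The space `U`. -/
abbrev Usp : Type := FreeM ⧸ Submodule.span ℚ relSet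

/-- The image of `u_α` in `U`. -/
noncomputable def uCl (α : MayaCl) : Usp :=
  Submodule.Quotient.mk (Finsupp.single α 1)

/-! ### Skew diagrams and rim hooks -/

/-- The cells of the skew diagram `μ/λ` (0-indexed rows and columns). -/
def cells (f g : ℕ → ℕ) : Set (ℕ × ℕ) := {c | f c.1 ≤ c.2 ∧ c.2 < g c.1}

/-- Two cells are adjacent iff they share an edge. -/
def adjCell (c d : ℕ × ℕ) : Prop :=
  (c.1 = d.1 ∧ (c.2 = d.2 + 1 ∨ d.2 = c.2 + 1)) ∨
  (c.2 = d.2 ∧ (c.1 = d.1 + 1 ∨ d.1 = c.1 + 1))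

/-- A set of cells is edgewise connected. -/
def ConnectedCells (s : Set (ℕ × ℕ)) : Prop :=
  ∀ c ∈ s, ∀ d ∈ s, Relation.ReflTransGen (fun x y => x ∈ s ∧ y ∈ s ∧ adjCell x y) c d

/-- No 2×2 block of cells. -/
def No2x2 (s : Set (ℕ × ℕ)) : Prop :=
  ¬ ∃ i j : ℕ, (i, j) ∈ s ∧ (i + 1, j) ∈ s ∧ (i, j + 1) ∈ s ∧ (i + 1, j + 1) ∈ s

/-- `μ/λ` is an `r`-hook (rim hook of length `r`). -/
def IsRHook (r : ℕ) (f g : ℕ → ℕ) : Prop :=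
  psize g = psize f + r ∧ ConnectedCells (cells f g) ∧ No2x2 (cells f g)

/-! ### Power sums are algebraically independent -/

/-- A surjective endomorphism of a Noetherian ring is injective. -/
theorem injective_of_surjective_ringEnd {R : Type*} [CommRing R] [IsNoetherianRing R]
    (f : R →+* R) (hf : Function.Surjective f) : Function.Injective f := by
  let I : ℕ →o Ideal R :=
    { toFun := fun k => RingHom.ker (f ^ k)
      monotone' := monotone_nat_of_le_succ fun k x hx => by
        rw [RingHom.mem_ker] at hx ⊢
        rw [pow_succ', RingHom.mul_def, RingHom.comp_apply, hx, map_zero] }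
  obtain ⟨k, hk⟩ := monotone_stabilizes_iff_noetherian.mpr ‹_› I
  have hsurj : Function.Surjective (f ^ k : R →+* R) := by
    rw [RingHom.coe_pow]
    exact hf.iterate k
  rw [injective_iff_map_eq_zero]
  intro x hx
  obtain ⟨y, rfl⟩ := hsurj x
  have hy : y ∈ I (k + 1) := by
    change y ∈ RingHom.ker (f ^ (k + 1))
    rw [RingHom.mem_ker, pow_succ', RingHom.mul_def, RingHom.comp_apply, hx]
  rw [← hk (k + 1) k.le_succ] at hy
  exact hy

/-- The homomorphism from the polynomial ring to symmetric polynomials in `n` variables sending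
the `i`-th variable to the `(i + 1)`-st power sum. -/
noncomputable def psumAlgHom (n : ℕ) :
    MvPolynomial (Fin n) ℚ →ₐ[ℚ] MvPolynomial.symmetricSubalgebra (Fin n) ℚ :=
  MvPolynomial.aeval fun i =>
    ⟨MvPolynomial.psum (Fin n) ℚ (i + 1), MvPolynomial.psum_isSymmetric _ _ _⟩

theorem psumAlgHom_val (n : ℕ) (q : MvPolynomial (Fin n) ℚ) :
    (psumAlgHom n q).val =
      MvPolynomial.aeval (fun i : Fin n => MvPolynomial.psum (Fin n) ℚ (i + 1)) q :=
  (Subalgebra.mvPolynomial_aeval_coe _ _ _).symm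

theorem esymm_mem_range_psum (n k : ℕ) (hk : k ≤ n) :
    MvPolynomial.esymm (Fin n) ℚ k ∈
      (MvPolynomial.aeval (R := ℚ)
        (fun i : Fin n => MvPolynomial.psum (Fin n) ℚ (i + 1))).range := by
  set A := (MvPolynomial.aeval (R := ℚ)
        (fun i : Fin n => MvPolynomial.psum (Fin n) ℚ (i + 1))).range
  induction k using Nat.strong_induction_on with
  | _ k ih =>
    rcases Nat.eq_zero_or_pos k with rfl | hpos
    · rw [MvPolynomial.esymm_zero]
      exact A.one_mem
    · have hp : ∀ m, 0 < m → m ≤ n → MvPolynomial.psum (Fin n) ℚ m ∈ A := by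
        intro m hm hmn
        refine ⟨MvPolynomial.X ⟨m - 1, by omega⟩, ?_⟩
        simp [Nat.sub_add_cancel hm]
      have key : (k : MvPolynomial (Fin n) ℚ) * MvPolynomial.esymm (Fin n) ℚ k ∈ A := by
        rw [MvPolynomial.mul_esymm_eq_sum]
        refine A.mul_mem (A.pow_mem (A.neg_mem A.one_mem) _) (A.sum_mem fun a ha => ?_)
        rw [Finset.mem_filter, Finset.HasAntidiagonal.mem_antidiagonal] at ha
        exact A.mul_mem (A.mul_mem (A.pow_mem (A.neg_mem A.one_mem) _)
          (ih _ ha.2 (by omega))) (hp _ (by omega) (by omega))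
      have h2 := A.smul_mem key ((k : ℚ)⁻¹)
      have hk0 : (k : ℚ) ≠ 0 := by positivity
      rwa [← nsmul_eq_mul, ← Nat.cast_smul_eq_nsmul ℚ, smul_smul, inv_mul_cancel₀ hk0,
        one_smul] at h2

theorem psumAlgHom_surjective (n : ℕ) : Function.Surjective (psumAlgHom n) := by
  intro p
  obtain ⟨q, rfl⟩ := MvPolynomial.esymmAlgHom_fin_surjective ℚ (le_refl n) p
  rw [← AlgHom.mem_range]
  induction q using MvPolynomial.induction_on with
  | C c =>
    rw [← MvPolynomial.algebraMap_eq, AlgHom.commutes]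
    exact Subalgebra.algebraMap_mem _ c
  | add p q hp hq =>
    rw [map_add]
    exact Subalgebra.add_mem _ hp hq
  | mul_X p i hp =>
    rw [map_mul]
    refine Subalgebra.mul_mem _ hp ?_
    obtain ⟨q, hq⟩ := esymm_mem_range_psum n (i + 1) i.2
    refine ⟨q, Subtype.ext ?_⟩
    refine (psumAlgHom_val n q).trans (hq.trans ?_)
    simp [MvPolynomial.esymmAlgHom]

theorem psumAlgHom_injective (n : ℕ) : Function.Injective (psumAlgHom n) := by
  let e := (MvPolynomial.esymmAlgEquiv (Fin n) ℚ (Fintype.card_fin n)).symm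
  have h := injective_of_surjective_ringEnd
    (e.toAlgHom.comp (psumAlgHom n) : MvPolynomial (Fin n) ℚ →+* MvPolynomial (Fin n) ℚ)
    (e.surjective.comp (psumAlgHom_surjective n))
  exact Function.Injective.of_comp (f := e) h

/-- A symmetric function vanishing in all sufficiently large numbers of variables is zero. -/
theorem eq_zero_of_ev_eq_zero (F : SymmAlg) (M : ℕ) (h : ∀ n, M ≤ n → ev n F = 0) : F = 0 := by
  let n := max M (F.vars.sup id + 1)
  obtain ⟨q, hqF⟩ := MvPolynomial.exists_rename_eq_of_vars_subset_range F (Fin.val : Fin n → ℕ)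
    Fin.val_injective (fun i hi => by
      have : i ≤ F.vars.sup id := Finset.le_sup (f := id) hi
      exact ⟨⟨i, by omega⟩, rfl⟩)
  have h0 := h n (le_max_left _ _)
  have hq : q = 0 := by
    apply psumAlgHom_injective n
    rw [map_zero]
    apply Subtype.ext
    rw [psumAlgHom_val]
    rw [← hqF, ev, MvPolynomial.aeval_rename] at h0
    exact h0
  rw [← hqF, hq, map_zero]

/-! ### Alternants of Maya sequences -/

/-- From index `n` on, `a` decreases in unit steps, and it lies below all earlier entries. -/
def IsStableAt (a : ℕ → ℤ) (n : ℕ) : Prop :=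
  (∀ m : ℕ, n ≤ m → a m = a n - ((m : ℤ) - n)) ∧ ∀ j : ℕ, j < n → a n < a j

theorem IsMaya.exists_isStableAt {a : ℕ → ℤ} (ha : IsMaya a) :
    ∃ N : ℕ, ∀ n : ℕ, N ≤ n → IsStableAt a n := by
  obtain ⟨N, hN⟩ := ha
  have hlin : ∀ m, N ≤ m → a m = a N - ((m : ℤ) - N) := by
    intro m hm
    induction m, hm using Nat.le_induction with
    | base => ring
    | succ m hm ih => rw [hN m hm, ih]; push_cast; ring
  refine ⟨N + ∑ j ∈ Finset.range N, (a j - a N).natAbs + 1, fun n hn => ⟨fun m hm => ?_,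
    fun j hj => ?_⟩⟩
  · rw [hlin m (by omega), hlin n (by omega)]
    ring
  · rw [hlin n (by omega)]
    by_cases hjN : j < N
    · have : (a j - a N).natAbs ≤ ∑ j ∈ Finset.range N, (a j - a N).natAbs :=
        Finset.single_le_sum (f := fun j => (a j - a N).natAbs) (fun _ _ => Nat.zero_le _)
          (Finset.mem_range.mpr hjN)
      omega
    · rw [hlin j (by omega)]
      omega

theorem IsStableAt.isMaya {a : ℕ → ℤ} {n : ℕ} (h : IsStableAt a n) : IsMaya a :=
  ⟨n, fun i hi => by
    rw [h.1 (i + 1) (by omega), h.1 i hi]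
    push_cast
    ring⟩

theorem permAct_of_lt {n : ℕ} (σ : Equiv.Perm (Fin n)) (a : ℕ → ℤ) (i : Fin n) :
    permAct σ a i = a (σ⁻¹ i : Fin n) := by
  simp [permAct]

theorem permAct_of_ge {n : ℕ} (σ : Equiv.Perm (Fin n)) (a : ℕ → ℤ) {i : ℕ} (hi : n ≤ i) :
    permAct σ a i = a i := by
  simp [permAct, Nat.not_lt.mpr hi]

theorem IsStableAt.permAct {a : ℕ → ℤ} {n : ℕ} (h : IsStableAt a n) (σ : Equiv.Perm (Fin n)) :
    IsStableAt (permAct σ a) n := by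
  refine ⟨fun m hm => ?_, fun j hj => ?_⟩
  · rw [permAct_of_ge σ a hm, permAct_of_ge σ a le_rfl, h.1 m hm]
  · rw [permAct_of_ge σ a le_rfl, permAct_of_lt σ a ⟨j, hj⟩]
    exact h.2 _ (Fin.is_lt _)

theorem IsStableAt.addAt {a : ℕ → ℤ} {n : ℕ} (h : IsStableAt a n) {i : ℕ} (hi : i < n) (k : ℕ) :
    IsStableAt (addAt a i k) n := by
  refine ⟨fun m hm => ?_, fun j hj => ?_⟩
  · simp only [RSF.addAt, Function.update_apply, if_neg (show m ≠ i by omega),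
      if_neg (show n ≠ i by omega)]
    exact h.1 m hm
  · simp only [RSF.addAt, Function.update_apply, if_neg (show n ≠ i by omega)]
    have := h.2 i hi
    have := h.2 j hj
    split_ifs <;> omega

/-- The action of a permutation of `Fin m` is that of its extension to `Fin n`. -/
theorem exists_permAct_eq {m n : ℕ} (hmn : m ≤ n) (σ : Equiv.Perm (Fin m)) :
    ∃ τ : Equiv.Perm (Fin n), Equiv.Perm.sign τ = Equiv.Perm.sign σ ∧
      ∀ a, permAct τ a = permAct σ a := by
  refine ⟨(σ⁻¹.viaFintypeEmbedding (Fin.castLEEmb hmn))⁻¹, ?_, fun a => funext fun i => ?_⟩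
  · rw [Equiv.Perm.sign_inv, Equiv.Perm.viaFintypeEmbedding_sign, Equiv.Perm.sign_inv]
  · by_cases hin : i < n
    · rw [permAct_of_lt _ a ⟨i, hin⟩, inv_inv]
      by_cases him : i < m
      · rw [permAct_of_lt σ a ⟨i, him⟩]
        have := Equiv.Perm.viaFintypeEmbedding_apply_image σ⁻¹ (Fin.castLEEmb hmn) ⟨i, him⟩
        exact congrArg (fun x : Fin n => a x) this
      · rw [permAct_of_ge σ a (by omega), Equiv.Perm.viaFintypeEmbedding_apply_notMem_range]
        rintro ⟨x, hx⟩
        have := congrArg Fin.val hx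
        simp at this
        omega
    · rw [permAct_of_ge _ a (by omega), permAct_of_ge σ a (by omega)]

/-- The alternant matrix `(x_i^{a_j - a_n - 1})`. -/
noncomputable def mayaMat (a : ℕ → ℤ) (n : ℕ) :
    Matrix (Fin n) (Fin n) (MvPolynomial (Fin n) ℚ) :=
  Matrix.of fun i j => MvPolynomial.X i ^ (a j - a n - 1).toNat

theorem det_mayaMat_permAct (a : ℕ → ℤ) {n : ℕ} (σ : Equiv.Perm (Fin n)) :
    (mayaMat (permAct σ a) n).det = ((Equiv.Perm.sign σ : ℤ) : ℚ) • (mayaMat a n).det := by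
  have : mayaMat (permAct σ a) n = (mayaMat a n).submatrix id (σ⁻¹ : Equiv.Perm (Fin n)) := by
    ext1 i j
    simp only [mayaMat, Matrix.of_apply, Matrix.submatrix_apply, id]
    rw [permAct_of_lt, permAct_of_ge σ a le_rfl]
  rw [this, Matrix.det_permute', Equiv.Perm.sign_inv, Int.cast_smul_eq_zsmul, zsmul_eq_mul]

/-- The partition `λ(a)` of a strictly decreasing Maya sequence, read off at a stable index. -/
def partOfMaya (a : ℕ → ℤ) (n : ℕ) : ℕ → ℕ := fun j => (a j - a n + j - n).toNat

section StrictlyDecreasing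

variable {a : ℕ → ℤ} {n : ℕ}

theorem StrictDec.sub_ge (hd : StrictDec a) {i j : ℕ} (hij : i ≤ j) : a j + j ≤ a i + i := by
  induction j, hij using Nat.le_induction with
  | base => exact le_rfl
  | succ j _ ih =>
    have := hd j (j + 1) j.lt_succ_self
    push_cast
    omega

theorem partOfMaya_eq_zero (h : IsStableAt a n) {i : ℕ} (hi : n ≤ i) : partOfMaya a n i = 0 := by
  have := h.1 i hi
  simp only [partOfMaya]
  omega

theorem isPartition_partOfMaya (h : IsStableAt a n) (hd : StrictDec a) :
    IsPartition (partOfMaya a n) := by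
  refine ⟨fun i j hij => ?_, n, fun i hi => partOfMaya_eq_zero h hi⟩
  have := hd.sub_ge hij
  simp only [partOfMaya]
  omega

theorem mayaCorresponds_partOfMaya (h : IsStableAt a n) (hd : StrictDec a) :
    MayaCorresponds a (partOfMaya a n) := by
  refine ⟨n, fun m hm j hj => ?_⟩
  have h1 := hd.sub_ge hj
  have h2 := h.1 m hm
  simp only [partOfMaya]
  omega

theorem schurMat_partOfMaya (hd : StrictDec a) : schurMat (partOfMaya a n) n = mayaMat a n := by
  ext1 i j
  simp only [schurMat, mayaMat, Matrix.of_apply, partOfMaya]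
  congr 1
  have := hd.sub_ge j.2.le
  omega

end StrictlyDecreasing

theorem exists_strictDec_permAct {a : ℕ → ℤ} {n : ℕ} (h : IsStableAt a n)
    (hinj : Function.Injective a) : ∃ σ : Equiv.Perm (Fin n), StrictDec (permAct σ a) := by
  let s := Tuple.sort fun i : Fin n => -a i
  have hs : Monotone ((fun i : Fin n => -a i) ∘ s) := Tuple.monotone_sort _
  refine ⟨s⁻¹, fun i j hij => ?_⟩
  have hst := h.permAct s⁻¹
  by_cases hj : j < n
  · have hi : i < n := hij.trans hj
    rw [permAct_of_lt _ a ⟨i, hi⟩, permAct_of_lt _ a ⟨j, hj⟩, inv_inv]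
    have h1 : -a (s ⟨i, hi⟩) ≤ -a (s ⟨j, hj⟩) := hs (Fin.mk_le_mk.mpr hij.le)
    have h2 : a (s ⟨i, hi⟩) ≠ a (s ⟨j, hj⟩) := fun he => by
      have := Fin.mk.inj (s.injective (Fin.ext (hinj he)))
      omega
    omega
  · have h1 := hst.1 j (by omega)
    by_cases hi : i < n
    · have := hst.2 i hi
      omega
    · have := hst.1 i (by omega)
      omega

/-! ### Schur functions of Maya sequences -/

section Schur

variable {S : (ℕ → ℕ) → SymmAlg} {SM : (ℕ → ℤ) → SymmAlg}

/-- The bialternant formula for generalized Maya diagrams. -/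
theorem ev_mul_det (hS : IsSchurFamily S) (hSM : IsMayaSchur S SM) {a : ℕ → ℤ} {n : ℕ}
    (h : IsStableAt a n) :
    ev n (SM a) * (schurMat emptyPart n).det = (mayaMat a n).det := by
  by_cases hinj : Function.Injective a
  · obtain ⟨σ, hd⟩ := exists_strictDec_permAct h hinj
    have hst := h.permAct σ
    rw [hSM.2 a h.isMaya n σ _ hd (mayaCorresponds_partOfMaya hst hd), map_smul, smul_mul_assoc,
      hS _ (isPartition_partOfMaya hst hd) n (Nat.sInf_le fun i hi => partOfMaya_eq_zero hst hi),
      schurMat_partOfMaya hd, det_mayaMat_permAct, smul_smul]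
    rw [← Int.cast_mul, ← Units.val_mul, Int.units_mul_self, Units.val_one, Int.cast_one, one_smul]
  · obtain ⟨i, j, hij, hne⟩ : ∃ i j, a i = a j ∧ i ≠ j := by
      simpa [Function.Injective] using hinj
    rw [hSM.1 a h.isMaya ⟨i, j, hne, hij⟩, map_zero, zero_mul]
    have hlt : ∀ i j, a i = a j → i ≠ j → i < n := by
      intro i j hij hne
      by_contra hi
      have h1 := h.1 i (by omega)
      by_cases hj : j < n
      · have := h.2 j hj
        omega
      · have := h.1 j (by omega)
        omega
    refine (Matrix.det_zero_of_column_eq (i := ⟨i, hlt i j hij hne⟩)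
      (j := ⟨j, hlt j i hij.symm hne.symm⟩) (by simpa using hne) fun k => ?_).symm
    simp [mayaMat, hij]

theorem det_schurMat_emptyPart_ne_zero (n : ℕ) : (schurMat emptyPart n).det ≠ 0 := by
  have : schurMat emptyPart n =
      (Matrix.vandermonde (MvPolynomial.X : Fin n → MvPolynomial (Fin n) ℚ)).submatrix id
        Fin.revPerm := by
    ext1 i j
    simp only [schurMat, emptyPart, Matrix.of_apply, Matrix.submatrix_apply, Matrix.vandermonde,
      id, Fin.revPerm_apply, Fin.val_rev]
    congr 1
    omega
  rw [this, Matrix.det_permute']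
  refine mul_ne_zero ?_
    (Matrix.det_vandermonde_ne_zero_iff.mpr (MvPolynomial.X_injective (R := ℚ)))
  rcases Int.units_eq_one_or (Equiv.Perm.sign (Fin.revPerm : Equiv.Perm (Fin n))) with h | h <;>
    simp [h]

theorem eq_of_ev_mul_det_eq (F G : SymmAlg) (M : ℕ)
    (h : ∀ n, M ≤ n → ev n F * (schurMat emptyPart n).det = ev n G * (schurMat emptyPart n).det) :
    F = G := by
  rw [← sub_eq_zero]
  refine eq_zero_of_ev_eq_zero _ M fun n hn => ?_
  rw [map_sub, sub_eq_zero]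
  exact mul_right_cancel₀ (det_schurMat_emptyPart_ne_zero n) (h n hn)

theorem mayaSchur_permAct (hS : IsSchurFamily S) (hSM : IsMayaSchur S SM) {a : ℕ → ℤ}
    (ha : IsMaya a) {n : ℕ} (σ : Equiv.Perm (Fin n)) :
    SM (permAct σ a) = ((Equiv.Perm.sign σ : ℤ) : ℚ) • SM a := by
  obtain ⟨N, hN⟩ := ha.exists_isStableAt
  refine eq_of_ev_mul_det_eq _ _ (max N n) fun m hm => ?_
  have hst := hN m ((le_max_left _ _).trans hm)
  obtain ⟨τ, hτ, hact⟩ := exists_permAct_eq ((le_max_right _ _).trans hm) σ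
  rw [← hact, ev_mul_det hS hSM (hst.permAct τ), det_mayaMat_permAct, hτ, map_smul,
    smul_mul_assoc, ev_mul_det hS hSM hst]

theorem sum_det_mayaMat_addAt {a : ℕ → ℤ} {n : ℕ} (h : IsStableAt a n) (k : ℕ) :
    ∑ i ∈ Finset.range n, (mayaMat (addAt a i k) n).det =
      (∑ i : Fin n, MvPolynomial.X i ^ k) * (mayaMat a n).det := by
  rw [Finset.sum_range]
  simp only [Matrix.det_apply]
  rw [Finset.sum_comm, Finset.mul_sum]
  refine Finset.sum_congr rfl fun σ _ => ?_
  rw [← Finset.smul_sum, mul_smul_comm]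
  congr 1
  rw [← Equiv.sum_comp σ (fun p => MvPolynomial.X p ^ k), Finset.sum_mul]
  refine Finset.sum_congr rfl fun i _ => ?_
  rw [← Finset.mul_prod_erase _ _ (Finset.mem_univ i),
    ← Finset.mul_prod_erase _ (fun j => mayaMat a n (σ j) j) (Finset.mem_univ i), ← mul_assoc]
  have hn : addAt a i k n = a n := by
    simp [addAt, i.2.ne']
  congr 1
  · simp only [mayaMat, Matrix.of_apply, hn]
    rw [← pow_add]
    congr 1
    have := h.2 i i.2
    simp only [addAt, Function.update_self]
    omega
  · refine Finset.prod_congr rfl fun j hj => ?_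
    have hji : (j : ℕ) ≠ i := fun he => (Finset.mem_erase.mp hj).1 (Fin.ext he)
    simp only [mayaMat, Matrix.of_apply, hn]
    simp [addAt, hji]

theorem ev_pwr (n : ℕ) {k : ℕ} (hk : 1 ≤ k) :
    ev n (pwr k) = ∑ i : Fin n, MvPolynomial.X i ^ k := by
  simp [ev, pwr, Nat.sub_add_cancel hk]

theorem mayaSchur_addAt_eq_zero (hSM : IsMayaSchur S SM) {a : ℕ → ℤ} {N : ℕ}
    (hN : IsStableAt a N) {k : ℕ} (hk : 1 ≤ k) {i : ℕ} (hi : N + k ≤ i) :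
    SM (addAt a i k) = 0 := by
  refine hSM.1 _ (addAtM ⟨a, hN.isMaya⟩ i k).2 ⟨i, i - k, by omega, ?_⟩
  simp only [addAt, Function.update_self, Function.update_apply, if_neg (show i - k ≠ i by omega)]
  rw [hN.1 i (by omega), hN.1 (i - k) (by omega)]
  omega

/-- Multiplication of a Schur function by a power sum. -/
theorem sum_mayaSchur_addAt (hS : IsSchurFamily S) (hSM : IsMayaSchur S SM) {a : ℕ → ℤ} {N : ℕ}
    (hN : ∀ n, N ≤ n → IsStableAt a n) {k : ℕ} (hk : 1 ≤ k) :
    ∑ i ∈ Finset.range (N + k), SM (addAt a i k) = pwr k * SM a := by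
  refine eq_of_ev_mul_det_eq _ _ (N + k) fun n hn => ?_
  have hst := hN n (by omega)
  have hsum : ∑ i ∈ Finset.range (N + k), SM (addAt a i k) =
      ∑ i ∈ Finset.range n, SM (addAt a i k) :=
    Finset.sum_subset (Finset.range_mono hn) fun i _ hi =>
      mayaSchur_addAt_eq_zero hSM (hN N le_rfl) hk (by simpa using hi)
  rw [hsum, map_sum, Finset.sum_mul, map_mul, mul_assoc, ev_mul_det hS hSM hst, ev_pwr n hk,
    ← sum_det_mayaMat_addAt hst]
  exact Finset.sum_congr rfl fun i hi =>
    ev_mul_det hS hSM (hst.addAt (Finset.mem_range.mp hi) k)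

end Schur

theorem rho_pwr_eq_zero {r k : ℕ} (hk : 1 ≤ k) (h : r ∣ k) : rho r (pwr k) = 0 := by
  simp [rho, pwr, Nat.sub_add_cancel hk, h]

/-- **Lemma 1.2.** (1) `S^(r)_{σα} = sgn(σ)·S^(r)_α` for all `α ∈ M`, `σ ∈ S_∞`.
(2) `Σ_{i≥1} S^(r)_{α+jrε_i} = 0` for all `α ∈ M`, `j ≥ 1`. -/
theorem reduced_schur_relations
    (r : ℕ) (hr : 2 ≤ r)
    (S : (ℕ → ℕ) → SymmAlg) (hS : IsSchurFamily S)
    (SM : (ℕ → ℤ) → SymmAlg) (hSM : IsMayaSchur S SM) :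
    (∀ a : ℕ → ℤ, IsMaya a → ∀ (n : ℕ) (σ : Equiv.Perm (Fin n)),
      rho r (SM (permAct σ a)) = ((Equiv.Perm.sign σ : ℤ) : ℚ) • rho r (SM a)) ∧
    (∀ a : ℕ → ℤ, IsMaya a → ∀ j : ℕ, 1 ≤ j →
      ∑ᶠ i : ℕ, rho r (SM (addAt a i ((j * r : ℕ) : ℤ))) = 0) := by
  refine ⟨fun a ha n σ => by rw [mayaSchur_permAct hS hSM ha, map_smul], fun a ha j hj => ?_⟩
  obtain ⟨N, hN⟩ := ha.exists_isStableAt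
  have hk : 1 ≤ j * r := Nat.mul_pos hj (by omega)
  rw [finsum_eq_sum_of_support_subset (s := Finset.range (N + j * r)), ← map_sum,
    sum_mayaSchur_addAt hS hSM hN hk, map_mul, rho_pwr_eq_zero hk (dvd_mul_left r j), zero_mul]
  intro i hi
  by_contra hni
  exact hi (by
    change rho r (SM (addAt a i ((j * r : ℕ) : ℤ))) = 0
    rw [mayaSchur_addAt_eq_zero hSM (hN N le_rfl) hk (by simpa using hni), map_zero])
end RSF
end

section
/- For every partition λ and all integers m, n ≥ 0, the image of the Schur function S_λ in ℚ[x_1,…,x_m,y_1,…,y_n] under the algebra map sending p_j to x_1^j+⋯+x_m^j+y_1^j+⋯+y_n^j equals Σ_{μ,ν} LR^λ_{μν} · ev_m(S_μ)(x_1,…,x_m) · ev_n(S_ν)(y_1,…,y_n), where the sum runs over all pairs of partitions (μ,ν). -/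
open scoped BigOperators Classical

namespace RSF

/-! ### Geometric series and Cauchy's determinant -/

section Kernel

variable {K : Type*} [CommRing K] {N : ℕ}

/-- The geometric series `Σ_k c^k z_j^k`. -/
noncomputable def geomSeries (c : K) (j : Fin N) : MvPowerSeries (Fin N) K :=
  fun b => if b = Finsupp.single j (b j) then c ^ b j else 0

theorem coeff_geomSeries (c : K) (j : Fin N) (b : Fin N →₀ ℕ) :
    MvPowerSeries.coeff b (geomSeries c j) = if b = Finsupp.single j (b j) then c ^ b j else 0 :=
  rfl

theorem geomSeries_mul_one_sub (c : K) (j : Fin N) :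
    geomSeries c j * (1 - MvPowerSeries.C c * MvPowerSeries.X j) = 1 := by
  ext b
  rw [mul_sub, mul_one, mul_left_comm, map_sub, MvPowerSeries.coeff_C_mul, MvPowerSeries.X,
    MvPowerSeries.coeff_mul_monomial, mul_one, MvPowerSeries.coeff_one, coeff_geomSeries,
    coeff_geomSeries]
  by_cases hb : b = Finsupp.single j (b j)
  · generalize b j = k at hb
    subst hb
    rcases k with _ | k
    · simp
    · rw [← Finsupp.single_tsub]
      simp [pow_succ']
  · have h0 : b ≠ 0 := by
      rintro rfl
      simp at hb
    rw [if_neg hb, if_neg h0]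
    by_cases h1 : Finsupp.single j 1 ≤ b
    · rw [if_pos h1, if_neg, mul_zero, sub_zero]
      intro h
      apply hb
      have h2 := tsub_add_cancel_of_le h1
      rw [h, ← Finsupp.single_add] at h2
      rw [← h2]
      simp
    · rw [if_neg h1, mul_zero, sub_zero]

theorem geomSeries_zero (j : Fin N) : geomSeries (0 : K) j = 1 := by
  simpa using geomSeries_mul_one_sub (0 : K) j

theorem map_geomSeries {L : Type*} [CommRing L] (φ : K →+* L) (c : K) (j : Fin N) :
    MvPowerSeries.map φ (geomSeries c j) = geomSeries (φ c) j := by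
  ext b
  simp only [MvPowerSeries.coeff_map, coeff_geomSeries]
  split_ifs <;> simp

theorem coeff_prod_geomSeries (c : Fin N → K) (b : Fin N →₀ ℕ) :
    MvPowerSeries.coeff b (∏ j, geomSeries (c j) j) = ∏ j, c j ^ b j := by
  rw [MvPowerSeries.coeff_prod, Finset.sum_eq_single
    (Finsupp.equivFunOnFinite.symm fun j => Finsupp.single j (b j))]
  · simp [coeff_geomSeries]
  · intro l hl hne
    rw [Finset.mem_finsuppAntidiag] at hl
    by_contra h
    apply hne
    have h1 : ∀ j, l j = Finsupp.single j (l j j) := by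
      intro j
      by_contra hj
      apply h
      apply Finset.prod_eq_zero (Finset.mem_univ j)
      rw [coeff_geomSeries, if_neg hj]
    have h2 : ∀ j, l j j = b j := by
      intro j
      rw [← hl.1, Finsupp.finsetSum_apply, Finset.sum_eq_single j]
      · intro i _ hij
        rw [h1 i, Finsupp.single_eq_of_ne hij.symm]
      · simp
    ext1 j
    rw [h1 j, h2 j]
    simp
  · intro h
    exfalso
    apply h
    rw [Finset.mem_finsuppAntidiag]
    refine ⟨?_, by simp⟩
    simp

/-- The Cauchy kernel `∏_{i,j} (1 - v_i z_j)⁻¹`. -/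
noncomputable def cauchyKernel (N : ℕ) {ι : Type*} [Fintype ι] (v : ι → K) :
    MvPowerSeries (Fin N) K :=
  ∏ i, ∏ j, geomSeries (v i) j

theorem map_cauchyKernel {L : Type*} [CommRing L] (φ : K →+* L) {ι : Type*} [Fintype ι]
    (v : ι → K) : MvPowerSeries.map φ (cauchyKernel N v) = cauchyKernel N (φ ∘ v) := by
  simp [cauchyKernel, map_prod, map_geomSeries]

/-- The alternant `det(v_i^{α_j})`. -/
noncomputable def alternant (v : Fin N → K) (α : Fin N → ℕ) : K :=
  (Matrix.of fun i j => v i ^ α j).det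

theorem map_alternant {L : Type*} [CommRing L] (φ : K →+* L) (v : Fin N → K) (α : Fin N → ℕ) :
    φ (alternant v α) = alternant (φ ∘ v) α := by
  rw [alternant, alternant, RingHom.map_det]
  congr 1
  ext i j
  simp

theorem alternant_comp_perm (v : Fin N → K) (α : Fin N → ℕ) (σ : Equiv.Perm (Fin N)) :
    alternant v (α ∘ σ) = Equiv.Perm.sign σ * alternant v α :=
  Matrix.det_permute' σ (Matrix.of fun i j => v i ^ α j)

theorem alternant_eq_zero_of_eq (v : Fin N → K) (α : Fin N → ℕ) {i j : Fin N} (hij : i ≠ j)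
    (h : α i = α j) : alternant v α = 0 :=
  Matrix.det_zero_of_column_eq hij fun k => by simp [h]

/-- The staircase exponents `N-1, …, 1, 0`. -/
def staircase (N : ℕ) (j : Fin N) : ℕ := N - 1 - j

theorem alternant_staircase (v : Fin N → K) :
    alternant v (staircase N) = ∏ i, ∏ j ∈ Finset.Ioi i, (v i - v j) := by
  have h := Matrix.det_projVandermonde (fun _ => 1) v
  simp only [one_mul] at h
  rw [← h, alternant]
  congr 1
  ext i j
  simp [Matrix.projVandermonde_apply, staircase, Fin.val_rev, Nat.sub_sub, add_comm]

theorem coeff_alternant_X (α : Fin N → ℕ) (b : Fin N →₀ ℕ) :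
    MvPowerSeries.coeff b (alternant (fun i => (MvPowerSeries.X i : MvPowerSeries (Fin N) K)) α) =
      ∑ σ : Equiv.Perm (Fin N), if ⇑b = α ∘ σ then ((Equiv.Perm.sign σ : ℤ) : K) else 0 := by
  rw [alternant, ← Matrix.det_transpose, Matrix.det_apply, map_sum]
  refine Finset.sum_congr rfl fun σ _ => ?_
  simp only [Units.smul_def, map_zsmul, Matrix.transpose_apply, Matrix.of_apply,
    MvPowerSeries.X_pow_eq, MvPowerSeries.prod_monomial, Finset.prod_const_one]
  rw [MvPowerSeries.coeff_monomial]
  have h : b = ∑ i, Finsupp.single i (α (σ i)) ↔ ⇑b = α ∘ σ := by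
    have h' : ⇑(∑ i, Finsupp.single i (α (σ i))) = α ∘ σ := by
      ext j
      simp [Finsupp.finsetSum_apply, Finsupp.single_apply]
    rw [← h', DFunLike.coe_fn_eq]
  simp only [h]
  split_ifs <;> simp

/-- The coefficients of the homogeneous polynomial `∏_{k ≠ i} (s - x_k t)` in `s` and `t`. -/
noncomputable def puncturedEsymm (x : Fin N → K) : Matrix (Fin N) (Fin N) K :=
  Matrix.of fun i l => ∑ t ∈ Finset.powersetCard (l : ℕ) {i}ᶜ, ∏ k ∈ t, -x k

theorem prod_compl_sub_mul (x : Fin N → K) (s t : K) (i : Fin N) :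
    ∏ k ∈ {i}ᶜ, (s - x k * t) = ∑ l, puncturedEsymm x i l * (t ^ (l : ℕ) * s ^ (l.rev : ℕ)) := by
  simp only [sub_eq_neg_add]
  have hc : ({i}ᶜ : Finset (Fin N)).card + 1 = N := by
    have := i.pos
    rw [Finset.card_compl, Finset.card_singleton, Fintype.card_fin]
    omega
  rw [Finset.prod_add, Finset.sum_powerset, hc, Finset.sum_range]
  refine Finset.sum_congr rfl fun l _ => ?_
  rw [puncturedEsymm, Matrix.of_apply, Finset.sum_mul]
  refine Finset.sum_congr rfl fun u hu => ?_
  rw [Finset.mem_powersetCard] at hu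
  rw [Finset.prod_const, Finset.card_sdiff_of_subset hu.1, hu.2, Fin.val_rev, ← mul_assoc]
  congr 1
  · simp only [← neg_mul, Finset.prod_mul_distrib, Finset.prod_const, hu.2]
  · congr 1
    omega

theorem det_puncturedEsymm_mul (x y z : Fin N → K) :
    (Matrix.of fun i j => ∏ k ∈ {i}ᶜ, (z j - x k * y j)).det =
      (puncturedEsymm x).det * ∏ i, ∏ j ∈ Finset.Ioi i, (y j * z i - y i * z j) := by
  rw [← Matrix.det_projVandermonde, ← Matrix.det_transpose (Matrix.projVandermonde y z),
    ← Matrix.det_mul]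
  congr 1
  ext i j
  simp [Matrix.mul_apply, prod_compl_sub_mul, Matrix.projVandermonde_apply]

theorem det_puncturedEsymm [IsDomain K] (x : Fin N → K) (hx : Function.Injective x) :
    (puncturedEsymm x).det = ∏ i, ∏ j ∈ Finset.Ioi i, (x j - x i) := by
  have h := det_puncturedEsymm_mul x 1 x
  have h0 : ∏ i, ∏ j ∈ Finset.Ioi i, (x i - x j) ≠ 0 := by
    simp only [Finset.prod_ne_zero_iff, sub_ne_zero]
    intro i _ j hj e
    exact (Finset.mem_Ioi.1 hj).ne (hx e)
  have hd : (Matrix.of fun i j => ∏ k ∈ {i}ᶜ, (x j - x k * (1 : Fin N → K) j)) =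
      Matrix.diagonal fun i => ∏ k ∈ {i}ᶜ, (x i - x k) := by
    ext i j
    rcases eq_or_ne i j with rfl | hij
    · simp
    · rw [Matrix.diagonal_apply_ne _ hij, Matrix.of_apply]
      exact Finset.prod_eq_zero (i := j) (by simpa using hij.symm) (by simp)
  rw [hd, Matrix.det_diagonal] at h
  simp only [Pi.one_apply, one_mul] at h
  rw [← Finset.prod_prod_Ioi_mul_eq_prod_prod_off_diag (fun k i => x i - x k)] at h
  simp only [Finset.prod_mul_distrib] at h
  rw [mul_comm] at h
  exact (mul_right_cancel₀ h0 h).symm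

theorem map_puncturedEsymm {L : Type*} [CommRing L] (φ : K →+* L) (x : Fin N → K) :
    φ (puncturedEsymm x).det = (puncturedEsymm (φ ∘ x)).det := by
  rw [RingHom.map_det]
  congr 1
  ext i j
  simp [puncturedEsymm, map_sum, map_prod]

/-- Cauchy's determinant identity. -/
theorem det_geomSeries [IsDomain K] (x : Fin N → K) (hx : Function.Injective x) :
    (Matrix.of fun i j => geomSeries (x i) j).det =
      MvPowerSeries.C (alternant x (staircase N)) *
        (alternant (fun i => (MvPowerSeries.X i : MvPowerSeries (Fin N) K)) (staircase N) *
          cauchyKernel N x) := by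
  set D : Fin N → MvPowerSeries (Fin N) K := fun j =>
    ∏ k, (1 - MvPowerSeries.C (x k) * MvPowerSeries.X j) with hD
  have hunit : (∏ j, D j) * cauchyKernel N x = 1 := by
    rw [cauchyKernel, Finset.prod_comm (f := fun i j => geomSeries (x i) j),
      ← Finset.prod_mul_distrib]
    refine Finset.prod_eq_one fun j _ => ?_
    rw [← Finset.prod_mul_distrib]
    refine Finset.prod_eq_one fun k _ => ?_
    rw [mul_comm, geomSeries_mul_one_sub]
  have h1 := Matrix.det_mul_row D (Matrix.of fun i j => geomSeries (x i) j)
  have h2 := det_puncturedEsymm_mul (MvPowerSeries.C ∘ x) (fun j : Fin N => MvPowerSeries.X j)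
    (1 : Fin N → MvPowerSeries (Fin N) K)
  have h3 : (Matrix.of fun i j => D j * (Matrix.of fun i j => geomSeries (x i) j) i j) =
      Matrix.of fun i j => ∏ k ∈ {i}ᶜ, ((1 : Fin N → MvPowerSeries (Fin N) K) j -
        (MvPowerSeries.C ∘ x) k * MvPowerSeries.X j) := by
    ext1 i j
    have h4 := geomSeries_mul_one_sub (x i) j
    simp only [Matrix.of_apply, hD]
    rw [Fintype.prod_eq_mul_prod_compl i, mul_right_comm, mul_comm _ (geomSeries _ _), h4, one_mul]
    rfl
  rw [h3, h2, ← map_puncturedEsymm, det_puncturedEsymm x hx] at h1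
  have h5 : (Matrix.of fun i j => geomSeries (x i) j).det =
      ((∏ j, D j) * (Matrix.of fun i j => geomSeries (x i) j).det) * cauchyKernel N x := by
    rw [mul_right_comm, hunit, one_mul]
  rw [h5, ← h1, ← mul_assoc]
  congr 1
  rw [alternant_staircase, alternant_staircase]
  simp only [map_prod, ← Finset.prod_mul_distrib]
  refine Finset.prod_congr rfl fun i _ => Finset.prod_congr rfl fun j _ => ?_
  simp only [Pi.one_apply, map_sub]
  ring

theorem coeff_det_geomSeries (x : Fin N → K) (b : Fin N →₀ ℕ) :
    MvPowerSeries.coeff b (Matrix.of fun i j => geomSeries (x i) j).det = alternant x b := by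
  rw [alternant, Matrix.det_apply, Matrix.det_apply, map_sum]
  refine Finset.sum_congr rfl fun σ _ => ?_
  simp only [Units.smul_def, map_zsmul, Matrix.of_apply]
  rw [coeff_prod_geomSeries fun i => x (σ i)]

end Kernel

/-! ### Partitions of bounded size -/

theorem IsPartition.eq_zero_of_plen_le {f : ℕ → ℕ} (hf : IsPartition f) {i : ℕ}
    (hi : plen f ≤ i) : f i = 0 :=
  Nat.sInf_mem (s := {N : ℕ | ∀ i : ℕ, N ≤ i → f i = 0}) hf.2 i hi

theorem plen_le {f : ℕ → ℕ} {N : ℕ} (h : ∀ i, N ≤ i → f i = 0) : plen f ≤ N :=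
  Nat.sInf_le h

theorem psize_eq_sum {f : ℕ → ℕ} {N : ℕ} (h : ∀ i, N ≤ i → f i = 0) :
    psize f = ∑ i ∈ Finset.range N, f i := by
  refine finsum_eq_sum_of_support_subset _ fun i hi => ?_
  rw [Finset.coe_range, Set.mem_Iio]
  by_contra hN
  exact hi (h i (not_lt.1 hN))

theorem IsPartition.apply_le_psize {f : ℕ → ℕ} (hf : IsPartition f) (i : ℕ) : f i ≤ psize f := by
  rcases lt_or_ge i (plen f) with hi | hi
  · rw [psize_eq_sum fun _ => hf.eq_zero_of_plen_le]
    exact Finset.single_le_sum (fun _ _ => Nat.zero_le _) (Finset.mem_range.2 hi)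
  · rw [hf.eq_zero_of_plen_le hi]
    exact Nat.zero_le _

theorem IsPartition.plen_le_psize {f : ℕ → ℕ} (hf : IsPartition f) : plen f ≤ psize f := by
  rw [psize_eq_sum fun _ => hf.eq_zero_of_plen_le]
  refine le_trans ?_ (Finset.card_nsmul_le_sum (Finset.range (plen f)) f 1 fun i hi => ?_)
  · simp
  · by_contra h0
    have h1 : plen f ≤ i :=
      plen_le fun j hj => le_antisymm ((hf.1 i j hj).trans (by omega)) (Nat.zero_le _)
    exact absurd (Finset.mem_range.1 hi) (not_lt.2 h1)

theorem finite_partitions_psize_le (d : ℕ) : {f | IsPartition f ∧ psize f ≤ d}.Finite := by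
  refine (Set.finite_range fun (g : Fin d → Fin (d + 1)) (i : ℕ) =>
    if h : i < d then (g ⟨i, h⟩ : ℕ) else 0).subset ?_
  rintro f ⟨hf, hd⟩
  refine ⟨fun i => ⟨f i, Nat.lt_succ_of_le ((hf.apply_le_psize i).trans hd)⟩, ?_⟩
  funext i
  dsimp only
  split_ifs with h
  · rfl
  · exact (hf.eq_zero_of_plen_le (hf.plen_le_psize.trans (hd.trans (not_lt.1 h)))).symm

/-- The partitions of size at most `d`. -/
noncomputable def partitionsUpTo (d : ℕ) : Finset (ℕ → ℕ) :=
  (finite_partitions_psize_le d).toFinset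

theorem mem_partitionsUpTo {d : ℕ} {f : ℕ → ℕ} :
    f ∈ partitionsUpTo d ↔ IsPartition f ∧ psize f ≤ d := by
  simp [partitionsUpTo]

theorem eq_zero_of_mem_partitionsUpTo {d N : ℕ} (hN : d ≤ N) {f : ℕ → ℕ}
    (hf : f ∈ partitionsUpTo d) (i : ℕ) (hi : N ≤ i) : f i = 0 := by
  rw [mem_partitionsUpTo] at hf
  exact hf.1.eq_zero_of_plen_le (hf.1.plen_le_psize.trans (hf.2.trans (hN.trans hi)))

/-- The strictly decreasing exponents `λ_j + N - j` attached to a partition. -/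
def shiftedParts (N : ℕ) (f : ℕ → ℕ) (j : Fin N) : ℕ := f j + staircase N j

theorem IsPartition.strictAnti_shiftedParts {f : ℕ → ℕ} (hf : IsPartition f) (N : ℕ) :
    StrictAnti (shiftedParts N f) := by
  intro i j hij
  have h1 := hf.1 i j hij.le
  have h2 := j.2
  simp only [shiftedParts, staircase]
  omega

theorem sum_shiftedParts {f : ℕ → ℕ} {N : ℕ} (h : ∀ i, N ≤ i → f i = 0) :
    ∑ j, shiftedParts N f j = psize f + ∑ j, staircase N j := by
  simp only [shiftedParts, Finset.sum_add_distrib, psize_eq_sum h, Finset.sum_range]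

theorem eq_of_shiftedParts_comp_eq {f g : ℕ → ℕ} {N : ℕ} (hf : IsPartition f)
    (hg : IsPartition g) (hf0 : ∀ i, N ≤ i → f i = 0) (hg0 : ∀ i, N ≤ i → g i = 0)
    {σ τ : Equiv.Perm (Fin N)} (h : shiftedParts N f ∘ σ = shiftedParts N g ∘ τ) :
    f = g ∧ σ = τ := by
  have h1 : shiftedParts N f = shiftedParts N g := by
    have hr : Set.range (shiftedParts N f) = Set.range (shiftedParts N g) := by
      rw [← σ.surjective.range_comp, h, τ.surjective.range_comp]
    have h2 := (StrictMono.range_inj (hf.strictAnti_shiftedParts N).dual_right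
      (hg.strictAnti_shiftedParts N).dual_right).1 (by
        rw [Set.range_comp, Set.range_comp, hr])
    exact funext fun i => congrFun h2 i
  refine ⟨funext fun i => ?_, ?_⟩
  · rcases lt_or_ge i N with hi | hi
    · exact Nat.add_right_cancel (congrFun h1 ⟨i, hi⟩)
    · rw [hf0 i hi, hg0 i hi]
  · ext1 i
    apply (hg.strictAnti_shiftedParts N).injective
    have := congrFun h i
    rwa [h1] at this

theorem exists_shiftedParts_eq {N : ℕ} {g : Fin N → ℕ} (hg : StrictAnti g) :
    ∃ f, IsPartition f ∧ (∀ i, N ≤ i → f i = 0) ∧ shiftedParts N f = g := by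
  have key : ∀ k i (h : i + k < N), g ⟨i + k, h⟩ + k ≤ g ⟨i, by omega⟩ := by
    intro k
    induction k with
    | zero => intro i h; exact le_rfl
    | succ k ih =>
      intro i h
      have h1 := ih i (by omega)
      have h2 : g ⟨i + (k + 1), h⟩ < g ⟨i + k, by omega⟩ := hg (Fin.mk_lt_mk.2 (by omega))
      omega
  refine ⟨fun i => if h : i < N then g ⟨i, h⟩ - (N - 1 - i) else 0, ⟨?_, N, ?_⟩, ?_, ?_⟩
  · intro i j hij
    dsimp only
    split_ifs with hj hi hi
    · obtain ⟨k, rfl⟩ := Nat.exists_eq_add_of_le hij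
      have := key k i hj
      omega
    · omega
    · omega
    · omega
  · intro i hi
    exact dif_neg (not_lt.2 hi)
  · intro i hi
    exact dif_neg (not_lt.2 hi)
  · ext i
    have := key (N - 1 - i) i (by omega)
    simp only [shiftedParts, staircase, i.2, dif_pos, Fin.eta] at this ⊢
    omega

theorem exists_shiftedParts_comp_eq {d N : ℕ} {b : Fin N → ℕ}
    (hb : Function.Injective b) (hd : ∑ j, b j ≤ d + ∑ j, staircase N j) :
    ∃ f ∈ partitionsUpTo d, ∃ σ : Equiv.Perm (Fin N), b = shiftedParts N f ∘ σ := by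
  set τ := Tuple.sort (OrderDual.toDual ∘ b) with hτ
  have hanti : StrictAnti (b ∘ τ) := by
    have h1 : Antitone (b ∘ τ) := fun i j hij => Tuple.monotone_sort (OrderDual.toDual ∘ b) hij
    exact h1.strictAnti_of_injective (hb.comp τ.injective)
  obtain ⟨f, hf, hf0, hfb⟩ := exists_shiftedParts_eq hanti
  refine ⟨f, mem_partitionsUpTo.2 ⟨hf, ?_⟩, τ⁻¹, ?_⟩
  · have h2 := sum_shiftedParts hf0
    rw [hfb] at h2
    have h3 : ∑ j, (b ∘ τ) j = ∑ j, b j := Equiv.sum_comp τ b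
    omega
  · rw [hfb]
    ext i
    simp

theorem alternant_eq_sum {K : Type*} [CommRing K] {d N : ℕ} (hN : d ≤ N) (v : Fin N → K)
    (b : Fin N →₀ ℕ) (hd : ∑ j, b j ≤ d + ∑ j, staircase N j) :
    alternant v b = ∑ f ∈ partitionsUpTo d, alternant v (shiftedParts N f) *
      MvPowerSeries.coeff b (alternant (fun i => (MvPowerSeries.X i : MvPowerSeries (Fin N) K))
        (shiftedParts N f)) := by
  have h1 : ∀ f ∈ partitionsUpTo d, alternant v (shiftedParts N f) *
      MvPowerSeries.coeff b (alternant (fun i => (MvPowerSeries.X i : MvPowerSeries (Fin N) K))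
        (shiftedParts N f)) =
      ∑ σ : Equiv.Perm (Fin N), if ⇑b = shiftedParts N f ∘ σ then alternant v b else 0 := by
    intro f _
    rw [coeff_alternant_X, Finset.mul_sum]
    refine Finset.sum_congr rfl fun σ _ => ?_
    split_ifs with h
    · rw [h, alternant_comp_perm, mul_comm]
    · rw [mul_zero]
  rw [Finset.sum_congr rfl h1]
  by_cases hb : Function.Injective b
  · obtain ⟨f, hf, σ, hfb⟩ := exists_shiftedParts_comp_eq hb hd
    have huniq : ∀ g ∈ partitionsUpTo d, ∀ τ : Equiv.Perm (Fin N),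
        ⇑b = shiftedParts N g ∘ τ → g = f ∧ τ = σ := fun g hg τ h =>
      eq_of_shiftedParts_comp_eq (mem_partitionsUpTo.1 hg).1 (mem_partitionsUpTo.1 hf).1
        (eq_zero_of_mem_partitionsUpTo hN hg) (eq_zero_of_mem_partitionsUpTo hN hf)
        (h.symm.trans hfb)
    rw [Finset.sum_eq_single_of_mem f hf, Finset.sum_eq_single_of_mem σ (Finset.mem_univ σ),
      if_pos hfb]
    · intro τ _ hτ
      exact if_neg fun h => hτ (huniq f hf τ h).2
    · intro g hg hgf
      exact Finset.sum_eq_zero fun τ _ => if_neg fun h => hgf (huniq g hg τ h).1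
  · have h0 : alternant v b = 0 := by
      simp only [Function.Injective, not_forall] at hb
      obtain ⟨i, j, hij, hne⟩ := hb
      exact alternant_eq_zero_of_eq v b hne hij
    simp [h0]

theorem coeff_alternant_shiftedParts {K : Type*} [CommRing K] {N : ℕ} {f g : ℕ → ℕ}
    (hf : IsPartition f) (hg : IsPartition g) (hf0 : ∀ i, N ≤ i → f i = 0)
    (hg0 : ∀ i, N ≤ i → g i = 0) :
    MvPowerSeries.coeff (Finsupp.equivFunOnFinite.symm (shiftedParts N f))
      (alternant (fun i => (MvPowerSeries.X i : MvPowerSeries (Fin N) K)) (shiftedParts N g)) =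
      if g = f then 1 else 0 := by
  rw [coeff_alternant_X, Finset.sum_eq_single_of_mem 1 (Finset.mem_univ _)]
  · have h : ⇑(Finsupp.equivFunOnFinite.symm (shiftedParts N f)) =
        shiftedParts N g ∘ (1 : Equiv.Perm (Fin N)) ↔ g = f := by
      constructor
      · intro h
        exact (eq_of_shiftedParts_comp_eq hg hf hg0 hf0 (τ := 1) h.symm).1
      · rintro rfl
        rfl
    simp only [h]
    simp
  · intro τ _ hτ
    exact if_neg fun h =>
      hτ (eq_of_shiftedParts_comp_eq hg hf hg0 hf0 (τ := 1) h.symm).2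

/-! ### Schur functions and the Cauchy kernel -/

theorem cauchyKernel_extend {K ι κ : Type*} [CommRing K] [Fintype ι] [Fintype κ] (N : ℕ) (e : ι ↪ κ)
    (v : ι → K) :
    cauchyKernel N (Function.extend e v 0) = cauchyKernel N v := by
  refine (Fintype.prod_of_injective e e.injective _ _ (fun i hi => ?_) fun i => ?_).symm
  · rw [Function.extend_apply' _ _ _ (by simpa using hi)]
    simp [geomSeries_zero]
  · rw [e.injective.extend_apply]

/-- The alternant `det(z_i^{α_j})` in the power series variables `z_1, …, z_N`. -/
noncomputable abbrev seriesAlternant (K : Type*) [CommRing K] {N : ℕ} (α : Fin N → ℕ) :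
    MvPowerSeries (Fin N) K :=
  alternant (fun i => MvPowerSeries.X i) α

theorem map_seriesAlternant {K L : Type*} [CommRing K] [CommRing L] (φ : K →+* L) {N : ℕ}
    (α : Fin N → ℕ) :
    MvPowerSeries.map φ (seriesAlternant K α) = seriesAlternant L α := by
  rw [seriesAlternant, map_alternant]
  congr 1
  ext1 i
  simp

/-- Evaluation of symmetric functions at a finite family `v`, sending `p_j` to `Σ_i v_i^j`. -/
noncomputable def evalAt {K ι : Type*} [CommRing K] [Algebra ℚ K] [Fintype ι] (v : ι → K) :
    SymmAlg →ₐ[ℚ] K :=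
  MvPolynomial.aeval fun j => ∑ i, v i ^ (j + 1)

section Evaluation

variable {K L ι : Type*} [CommRing K] [Algebra ℚ K] [CommRing L] [Algebra ℚ L] [Fintype ι]

theorem map_evalAt (φ : K →ₐ[ℚ] L) (v : ι → K) (F : SymmAlg) :
    φ (evalAt v F) = evalAt (φ ∘ v) F := by
  have h : φ.comp (evalAt v) = evalAt (φ ∘ v) := by
    ext j
    simp [evalAt]
  exact DFunLike.congr_fun h F

theorem evalAt_extend {κ : Type*} [Fintype κ] (e : ι ↪ κ) (v : ι → K) :
    evalAt (Function.extend e v 0) = evalAt v := by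
  ext j
  simp only [evalAt, MvPolynomial.aeval_X]
  refine (Fintype.sum_of_injective e e.injective _ _ (fun i hi => ?_) fun i => ?_).symm
  · rw [Function.extend_apply' _ _ _ (by simpa using hi)]
    simp
  · rw [e.injective.extend_apply]

theorem evalAt_mul_alternant {S : (ℕ → ℕ) → SymmAlg} (hS : IsSchurFamily S) {f : ℕ → ℕ}
    (hf : IsPartition f) {N : ℕ} (hN : plen f ≤ N) (v : Fin N → K) :
    evalAt v (S f) * alternant v (staircase N) = alternant v (shiftedParts N f) := by
  have h : evalAt (MvPolynomial.X : Fin N → MvPolynomial (Fin N) ℚ) (S f) *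
      alternant MvPolynomial.X (staircase N) = alternant MvPolynomial.X (shiftedParts N f) := by
    have h0 := hS f hf N hN
    have h1 : schurMat emptyPart N = Matrix.of fun i j => MvPolynomial.X i ^ staircase N j := by
      ext1 i j
      simp [schurMat, emptyPart, staircase]
    rw [h1] at h0
    exact h0
  have h2 := congrArg (MvPolynomial.aeval v) h
  have h3 : (MvPolynomial.aeval v : MvPolynomial (Fin N) ℚ →ₐ[ℚ] K) ∘ MvPolynomial.X = v := by
    ext i
    simp
  have h4 : ∀ α, MvPolynomial.aeval v (alternant (MvPolynomial.X (R := ℚ)) α) =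
      alternant v α := fun α => by
    conv_rhs => rw [← h3]
    exact map_alternant (MvPolynomial.aeval v : MvPolynomial (Fin N) ℚ →ₐ[ℚ] K).toRingHom _ α
  rwa [map_mul, map_evalAt, h3, h4, h4] at h2

end Evaluation

section Coefficients

variable {S : (ℕ → ℕ) → SymmAlg} {K ι : Type*} [CommRing K] [Algebra ℚ K] [Fintype ι]

/-- The Cauchy identity, coefficientwise, for indeterminates. -/
theorem coeff_alternant_mul_cauchyKernel_X (hS : IsSchurFamily S) {d N : ℕ} (hN : d ≤ N)
    (b : Fin N →₀ ℕ)
    (hd : ∑ j, b j ≤ d + ∑ j, staircase N j) :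
    MvPowerSeries.coeff b (seriesAlternant (MvPolynomial (Fin N) ℚ) (staircase N) *
        cauchyKernel N MvPolynomial.X) =
      ∑ f ∈ partitionsUpTo d, evalAt MvPolynomial.X (S f) *
        MvPowerSeries.coeff b (seriesAlternant (MvPolynomial (Fin N) ℚ) (shiftedParts N f)) := by
  have hX : Function.Injective (MvPolynomial.X : Fin N → MvPolynomial (Fin N) ℚ) :=
    MvPolynomial.X_injective
  have h0 : alternant (MvPolynomial.X : Fin N → MvPolynomial (Fin N) ℚ) (staircase N) ≠ 0 := by
    rw [alternant_staircase]
    simp only [Finset.prod_ne_zero_iff, sub_ne_zero]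
    intro i _ j hj e
    exact (Finset.mem_Ioi.1 hj).ne (hX e)
  apply mul_left_cancel₀ h0
  rw [← MvPowerSeries.coeff_C_mul, ← det_geomSeries _ hX, coeff_det_geomSeries,
    alternant_eq_sum hN _ b hd, Finset.mul_sum]
  refine Finset.sum_congr rfl fun f hf => ?_
  have hf' := mem_partitionsUpTo.1 hf
  rw [← evalAt_mul_alternant hS hf'.1 (hf'.1.plen_le_psize.trans (hf'.2.trans hN)), mul_assoc,
    mul_left_comm]

/-- The Cauchy identity, coefficientwise. -/
theorem coeff_alternant_mul_cauchyKernel (hS : IsSchurFamily S) {d N : ℕ} (hN : d ≤ N)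
    (hι : Fintype.card ι ≤ N) (v : ι → K) (b : Fin N →₀ ℕ)
    (hd : ∑ j, b j ≤ d + ∑ j, staircase N j) :
    MvPowerSeries.coeff b (seriesAlternant K (staircase N) * cauchyKernel N v) =
      ∑ f ∈ partitionsUpTo d, evalAt v (S f) *
        MvPowerSeries.coeff b (seriesAlternant K (shiftedParts N f)) := by
  obtain ⟨e⟩ : Nonempty (ι ↪ Fin N) :=
    Function.Embedding.nonempty_of_card_le (by rwa [Fintype.card_fin])
  rw [← evalAt_extend e, ← cauchyKernel_extend N e]
  generalize Function.extend e v 0 = w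
  set φ : MvPolynomial (Fin N) ℚ →ₐ[ℚ] K := MvPolynomial.aeval w with hφ
  have hw : φ ∘ MvPolynomial.X = w := by
    ext i
    simp [hφ]
  have h := congrArg φ (coeff_alternant_mul_cauchyKernel_X hS hN b hd)
  have hc : ∀ P : MvPowerSeries (Fin N) (MvPolynomial (Fin N) ℚ),
      φ (MvPowerSeries.coeff b P) = MvPowerSeries.coeff b (MvPowerSeries.map φ.toRingHom P) :=
    fun P => rfl
  have hw' : (φ.toRingHom : MvPolynomial (Fin N) ℚ → K) ∘ MvPolynomial.X = w := hw
  simp only [map_sum, map_mul φ, hc, map_mul, map_evalAt, map_seriesAlternant, hw,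
    map_cauchyKernel, hw'] at h
  exact h

theorem coeff_alternant_mul_cauchyKernel_mul (hS : IsSchurFamily S) {d N : ℕ} (hN : d ≤ N)
    (hι : Fintype.card ι ≤ N) (v : ι → K) (P : MvPowerSeries (Fin N) K) (b : Fin N →₀ ℕ)
    (hd : ∑ j, b j ≤ d + ∑ j, staircase N j) :
    MvPowerSeries.coeff b (seriesAlternant K (staircase N) * cauchyKernel N v * P) =
      ∑ f ∈ partitionsUpTo d, evalAt v (S f) *
        MvPowerSeries.coeff b (seriesAlternant K (shiftedParts N f) * P) := by
  simp only [MvPowerSeries.coeff_mul _ (seriesAlternant K (shiftedParts N _)) P, Finset.mul_sum]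
  rw [MvPowerSeries.coeff_mul, Finset.sum_comm]
  refine Finset.sum_congr rfl fun p hp => ?_
  have hp' := Finset.HasAntidiagonal.mem_antidiagonal.1 hp
  have hpd : ∑ j, p.1 j ≤ d + ∑ j, staircase N j := by
    refine le_trans (Finset.sum_le_sum fun j _ => ?_) hd
    rw [← hp']
    exact Nat.le_add_right _ _
  rw [coeff_alternant_mul_cauchyKernel hS hN hι v p.1 hpd, Finset.sum_mul]
  exact Finset.sum_congr rfl fun f _ => mul_assoc _ _ _

theorem sum_equivFunOnFinite_shiftedParts_le {f : ℕ → ℕ} {d N : ℕ} (hd : psize f ≤ d)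
    (hf0 : ∀ i, N ≤ i → f i = 0) :
    ∑ j, (Finsupp.equivFunOnFinite.symm (shiftedParts N f)) j ≤ d + ∑ j, staircase N j := by
  simp only [Finsupp.equivFunOnFinite_symm_apply_apply]
  rw [sum_shiftedParts hf0]
  omega

/-- A Schur function is a coefficient of the antisymmetrized Cauchy kernel. -/
theorem coeff_shiftedParts_alternant_mul_cauchyKernel (hS : IsSchurFamily S) {f : ℕ → ℕ}
    (hf : IsPartition f) {N : ℕ} (hN : psize f ≤ N) (hι : Fintype.card ι ≤ N) (v : ι → K) :
    MvPowerSeries.coeff (Finsupp.equivFunOnFinite.symm (shiftedParts N f))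
      (seriesAlternant K (staircase N) * cauchyKernel N v) = evalAt v (S f) := by
  have hmem : f ∈ partitionsUpTo (psize f) := mem_partitionsUpTo.2 ⟨hf, le_rfl⟩
  have hf0 := eq_zero_of_mem_partitionsUpTo hN hmem
  rw [coeff_alternant_mul_cauchyKernel hS hN hι v _
    (sum_equivFunOnFinite_shiftedParts_le le_rfl hf0), Finset.sum_eq_single_of_mem f hmem]
  · rw [coeff_alternant_shiftedParts hf hf hf0 hf0, if_pos rfl, mul_one]
  · intro g hg hgf
    rw [coeff_alternant_shiftedParts hf (mem_partitionsUpTo.1 hg).1 hf0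
      (eq_zero_of_mem_partitionsUpTo hN hg), if_neg hgf, mul_zero]

theorem coeff_shiftedParts_schur_mul_schur (hS : IsSchurFamily S)
    {LR : (ℕ → ℕ) → List (ℕ → ℕ) → ℚ} (hLR : IsLRFamily S LR) {f μ ν : ℕ → ℕ}
    (hf : IsPartition f) (hμ : IsPartition μ)
    (hν : IsPartition ν) {N : ℕ} (hfN : psize f ≤ N) (hN : psize μ + psize ν ≤ N) :
    MvPowerSeries.coeff (Finsupp.equivFunOnFinite.symm (shiftedParts N f))
      (seriesAlternant K (shiftedParts N ν) *
        evalAt (fun i : Fin N => (MvPowerSeries.X i : MvPowerSeries (Fin N) K)) (S μ)) =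
      algebraMap ℚ K (LR f [μ, ν]) := by
  have hplen : ∀ g, IsPartition g → psize g ≤ N → plen g ≤ N := fun g hg h =>
    hg.plen_le_psize.trans h
  have hzero : ∀ g, IsPartition g → psize g ≤ N → ∀ i, N ≤ i → g i = 0 := fun g hg h i hi =>
    hg.eq_zero_of_plen_le ((hplen g hg h).trans hi)
  have hsupp : (Function.support fun g => LR g [μ, ν] • S g) ⊆ partitionsUpTo N := by
    intro g hg
    have hg' : LR g [μ, ν] ≠ 0 := fun h => hg (by simp [h])
    have hgp : IsPartition g := by
      by_contra h
      exact hg' (hLR.1 g _ h)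
    refine mem_partitionsUpTo.2 ⟨hgp, ?_⟩
    rw [hLR.2.1 g _ hg']
    simpa using hN
  have hprod : S μ * S ν = ∑ g ∈ partitionsUpTo N, LR g [μ, ν] • S g := by
    have h := hLR.2.2 [μ, ν] (by simp [hμ, hν])
    rw [finsum_eq_sum_of_support_subset _ hsupp] at h
    simpa using h
  rw [seriesAlternant, ← evalAt_mul_alternant hS hν (hplen ν hν (by omega)), mul_comm,
    ← mul_assoc, ← map_mul, hprod, map_sum, Finset.sum_mul, map_sum]
  have hterm : ∀ g ∈ partitionsUpTo N,
      MvPowerSeries.coeff (Finsupp.equivFunOnFinite.symm (shiftedParts N f))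
        (evalAt (fun i : Fin N => (MvPowerSeries.X i : MvPowerSeries (Fin N) K))
          (LR g [μ, ν] • S g) * seriesAlternant K (staircase N)) =
      if g = f then algebraMap ℚ K (LR g [μ, ν]) else 0 := by
    intro g hg
    have hg' := mem_partitionsUpTo.1 hg
    rw [map_smul, smul_mul_assoc, seriesAlternant,
      evalAt_mul_alternant hS hg'.1 (hplen g hg'.1 hg'.2), ← algebraMap_smul K,
      MvPowerSeries.coeff_smul,
      coeff_alternant_shiftedParts hf hg'.1 (hzero f hf hfN) (hzero g hg'.1 hg'.2)]
    split_ifs <;> simp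
  rw [Finset.sum_congr rfl hterm, Finset.sum_ite_eq' _ f,
    if_pos (mem_partitionsUpTo.2 ⟨hf, hfN⟩)]

/-- The coproduct formula as a finite sum, for arbitrary values of the variables. -/
theorem evalAt_sumElim (hS : IsSchurFamily S) {LR : (ℕ → ℕ) → List (ℕ → ℕ) → ℚ}
    (hLR : IsLRFamily S LR) {f : ℕ → ℕ} (hf : IsPartition f) {κ : Type*} [Fintype κ]
    (x : ι → K) (y : κ → K) :
    evalAt (Sum.elim x y) (S f) = ∑ μ ∈ partitionsUpTo (psize f), ∑ ν ∈ partitionsUpTo (psize f),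
      LR f [μ, ν] • (evalAt x (S μ) * evalAt y (S ν)) := by
  set d := psize f with hd
  set N := d + d + Fintype.card ι + Fintype.card κ with hN
  have hdN : d ≤ N := by omega
  have hb := sum_equivFunOnFinite_shiftedParts_le hd.ge fun i (hi : N ≤ i) =>
    hf.eq_zero_of_plen_le (hf.plen_le_psize.trans (hdN.trans hi))
  have hC : cauchyKernel N (Sum.elim x y) = cauchyKernel N x * cauchyKernel N y := by
    simp [cauchyKernel, Fintype.prod_sum_type]
  rw [← coeff_shiftedParts_alternant_mul_cauchyKernel hS hf hdN
    (by rw [Fintype.card_sum]; omega), hC, ← mul_assoc,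
    coeff_alternant_mul_cauchyKernel_mul hS hdN (by omega) x _ _ hb]
  refine Finset.sum_congr rfl fun μ hμ => ?_
  have hμ' := mem_partitionsUpTo.1 hμ
  rw [seriesAlternant,
    ← evalAt_mul_alternant hS hμ'.1 (hμ'.1.plen_le_psize.trans (hμ'.2.trans hdN)), mul_assoc,
    mul_comm (evalAt (fun i : Fin N => (MvPowerSeries.X i : MvPowerSeries (Fin N) K)) (S μ)),
    coeff_alternant_mul_cauchyKernel_mul hS hdN (by omega) y _ _ hb, Finset.mul_sum]
  refine Finset.sum_congr rfl fun ν hν => ?_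
  have hν' := mem_partitionsUpTo.1 hν
  rw [coeff_shiftedParts_schur_mul_schur hS hLR hf hμ'.1 hν'.1 hdN (by omega), Algebra.smul_def]
  ring

end Coefficients

/-- **Proposition 1.1 (4).** `S_λ(x,y) = Σ_{μ,ν} LR^λ_{μν} S_μ(x) S_ν(y)`:
evaluating `S_λ` in the variables `x_1, …, x_m, y_1, …, y_n` gives the sum over pairs of
partitions `(μ,ν)` of `LR^λ_{μν}` times the product of `S_μ` in the `x`'s and `S_ν` in
the `y`'s. -/
theorem schur_coproduct
    (S : (ℕ → ℕ) → SymmAlg) (hS : IsSchurFamily S)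
    (LR : (ℕ → ℕ) → List (ℕ → ℕ) → ℚ) (hLR : IsLRFamily S LR)
    (f : ℕ → ℕ) (hf : IsPartition f) (m n : ℕ) :
    MvPolynomial.aeval
        (fun j : ℕ => ∑ i : Fin m ⊕ Fin n, (MvPolynomial.X i : MvPolynomial (Fin m ⊕ Fin n) ℚ) ^ (j + 1))
        (S f) =
      ∑ᶠ (μ : ℕ → ℕ) (ν : ℕ → ℕ),
        (if IsPartition μ ∧ IsPartition ν then LR f [μ, ν] else 0) •
          (MvPolynomial.rename Sum.inl (ev m (S μ)) *
           MvPolynomial.rename Sum.inr (ev n (S ν))) := by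
  have hx : ∀ F : SymmAlg, MvPolynomial.rename Sum.inl (ev m F) =
      evalAt (fun i => (MvPolynomial.X (Sum.inl i) : MvPolynomial (Fin m ⊕ Fin n) ℚ)) F := by
    intro F
    refine (map_evalAt (MvPolynomial.rename Sum.inl) MvPolynomial.X F).trans ?_
    congr 2
    ext1 i
    simp
  have hy : ∀ F : SymmAlg, MvPolynomial.rename Sum.inr (ev n F) =
      evalAt (fun i => (MvPolynomial.X (Sum.inr i) : MvPolynomial (Fin m ⊕ Fin n) ℚ)) F := by
    intro F
    refine (map_evalAt (MvPolynomial.rename Sum.inr) MvPolynomial.X F).trans ?_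
    congr 2
    ext1 i
    simp
  have hxy : (MvPolynomial.X : _ → MvPolynomial (Fin m ⊕ Fin n) ℚ) =
      Sum.elim (fun i => MvPolynomial.X (Sum.inl i)) (fun i => MvPolynomial.X (Sum.inr i)) := by
    ext1 i
    cases i <;> rfl
  have hmem : ∀ μ ν, (if IsPartition μ ∧ IsPartition ν then LR f [μ, ν] else 0) ≠ 0 →
      μ ∈ partitionsUpTo (psize f) ∧ ν ∈ partitionsUpTo (psize f) := by
    intro μ ν h
    rw [ne_eq, ite_eq_right_iff, Classical.not_imp] at h
    have h1 := hLR.2.1 f _ h.2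
    simp only [List.map_cons, List.map_nil, List.sum_cons, List.sum_nil, add_zero] at h1
    exact ⟨mem_partitionsUpTo.2 ⟨h.1.1, by omega⟩, mem_partitionsUpTo.2 ⟨h.1.2, by omega⟩⟩
  simp only [hx, hy]
  refine Eq.trans ?_ (finsum_eq_sum_of_support_subset (s := partitionsUpTo (psize f)) _ ?_).symm
  · have h := evalAt_sumElim hS hLR hf
      (fun i => (MvPolynomial.X (Sum.inl i) : MvPolynomial (Fin m ⊕ Fin n) ℚ))
      (fun i => (MvPolynomial.X (Sum.inr i) : MvPolynomial (Fin m ⊕ Fin n) ℚ))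
    rw [← hxy] at h
    refine h.trans (Finset.sum_congr rfl fun μ hμ => ?_)
    rw [finsum_eq_sum_of_support_subset (s := partitionsUpTo (psize f))]
    · refine Finset.sum_congr rfl fun ν hν => ?_
      rw [if_pos ⟨(mem_partitionsUpTo.1 hμ).1, (mem_partitionsUpTo.1 hν).1⟩]
    · intro ν hν
      exact (hmem μ ν fun h0 => hν (by simp only [h0, zero_smul])).2
  · intro μ hμ
    by_contra h
    refine hμ (finsum_eq_zero_of_forall_eq_zero fun ν => ?_)
    have h0 := not_imp_comm.1 (hmem μ ν) fun h' => h h'.1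
    simp only [h0, zero_smul]

end RSF
end
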